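/- For every non-negative integer N, the functions s ↦ Z_0(s), s ↦ Z_2(s), s ↦ Z_4(s), …, s ↦ Z_{2⌊N/2⌋}(s), viewed as functions from {s ∈ ℂ : Re(s) > 2} to ℂ, are linearly independent over ℚ; consequently, the ℚ-linear span of the functions {s ↦ Z_c(s) : 0 ≤ c ≤ N} has dimension ⌊N/2⌋ + 1 over ℚ. -/

import Mathlib

/-- The Euler–Zagier double zeta function `ζ(-c, s+c) = ∑_{m,n ≥ 1} m^c / (m+n)^(s+c)`. -/
noncomputable def Z (c : ℕ) (s : ℂ) : ℂ :=
  ∑' p : ℕ+ × ℕ+, ((p.1 : ℕ) : ℂ) ^ c / ((((p.1 : ℕ) + (p.2 : ℕ) : ℕ)) : ℂ) ^ (s + (c : ℂ))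

/-- The function `s ↦ Z_c(s)` viewed as a function on `{s : ℂ | Re s > 2}`. -/
noncomputable def F (c : ℕ) : {s : ℂ // 2 < s.re} → ℂ := fun s => Z c s.val

/-- The sum `∑_{0 < m < k} (m / k)^c`, the coefficient of `k^(-s)` in the Dirichlet series
`Z c s`. -/
def ratioPowSum (c k : ℕ) : ℚ :=
  ∑ p ∈ Finset.HasAntidiagonal.antidiagonal k, if p.1 = 0 ∨ p.2 = 0 then 0 else ((p.1 : ℚ) / k) ^ c

/-- The summand of `Z c s`, extended by zero to `ℕ × ℕ`. -/
noncomputable def doubleTerm (c : ℕ) (s : ℂ) (p : ℕ × ℕ) : ℂ :=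
  if p.1 = 0 ∨ p.2 = 0 then 0 else (p.1 : ℂ) ^ c / ((p.1 + p.2 : ℕ) : ℂ) ^ (s + (c : ℂ))

theorem summable_doubleTerm (c : ℕ) {s : ℂ} (hs : 2 < s.re) : Summable (doubleTerm c s) := by
  have h1 : Summable fun n : ℕ => (n : ℝ) ^ (-(s.re / 2)) :=
    Real.summable_nat_rpow.2 (by linarith)
  have h2 := h1.mul_of_nonneg h1 (fun n => by positivity) (fun n => by positivity)
  refine Summable.of_norm_bounded h2 fun p => ?_
  obtain ⟨m, n⟩ := p
  unfold doubleTerm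
  split_ifs with h
  · simp only [norm_zero]; positivity
  · simp only [not_or] at h
    have hm : 0 < (m : ℝ) := by exact_mod_cast Nat.pos_of_ne_zero h.1
    have hn : 0 < (n : ℝ) := by exact_mod_cast Nat.pos_of_ne_zero h.2
    have hpos : 0 < m + n := by omega
    have hk : 0 < (m : ℝ) + n := by positivity
    rw [norm_div, norm_pow, Complex.norm_natCast, Complex.norm_natCast_cpow_of_pos hpos]
    simp only [Complex.add_re, Complex.natCast_re, Nat.cast_add]
    rw [Real.rpow_add hk, Real.rpow_natCast, ← Real.mul_rpow hm.le hn.le]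
    calc (m : ℝ) ^ c / (((m : ℝ) + n) ^ s.re * ((m : ℝ) + n) ^ c)
        ≤ ((m : ℝ) + n) ^ c / (((m : ℝ) + n) ^ s.re * ((m : ℝ) + n) ^ c) := by
          gcongr; linarith
      _ = (((m : ℝ) + n) ^ 2) ^ (-(s.re / 2)) := by
          rw [← Real.rpow_natCast _ 2, ← Real.rpow_mul hk.le,
            show ((2 : ℕ) : ℝ) * -(s.re / 2) = -s.re by push_cast; ring, Real.rpow_neg hk.le]
          field_simp
      _ ≤ _ := Real.rpow_le_rpow_of_nonpos (by positivity) (by nlinarith) (by linarith)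

theorem tsum_doubleTerm (c : ℕ) (s : ℂ) : ∑' p, doubleTerm c s p = Z c s := by
  have hinj : Function.Injective (fun p : ℕ+ × ℕ+ => ((p.1 : ℕ), (p.2 : ℕ))) := by
    rintro ⟨a, b⟩ ⟨a', b'⟩ h
    simpa using h
  rw [← hinj.tsum_eq]
  · simp [Z, doubleTerm]
  · rintro ⟨m, n⟩ h
    have h' : ¬(m = 0 ∨ n = 0) := fun h0 => h (by simp [doubleTerm, h0])
    rw [not_or] at h'
    exact ⟨(⟨m, Nat.pos_of_ne_zero h'.1⟩, ⟨n, Nat.pos_of_ne_zero h'.2⟩), rfl⟩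

theorem sum_antidiagonal_doubleTerm (c k : ℕ) (s : ℂ) :
    ∑ p ∈ Finset.HasAntidiagonal.antidiagonal k, doubleTerm c s p =
      LSeries.term (fun k => (ratioPowSum c k : ℂ)) s k := by
  rcases eq_or_ne k 0 with rfl | hk
  · simp [doubleTerm]
  · rw [LSeries.term_of_ne_zero hk, ratioPowSum, Rat.cast_sum, Finset.sum_div]
    refine Finset.sum_congr rfl fun p hp => ?_
    rw [Finset.HasAntidiagonal.mem_antidiagonal] at hp
    have hk' : (k : ℂ) ≠ 0 := by exact_mod_cast hk
    unfold doubleTerm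
    split_ifs
    · simp
    · rw [hp, Complex.cpow_add _ _ hk', Complex.cpow_natCast]
      push_cast
      rw [div_pow, div_div, mul_comm]

theorem lseriesHasSum_Z (c : ℕ) {s : ℂ} (hs : 2 < s.re) :
    LSeriesHasSum (fun k => (ratioPowSum c k : ℂ)) s (Z c s) := by
  have h := (summable_doubleTerm c hs).hasSum
  rw [tsum_doubleTerm, ← Finset.HasAntidiagonal.sigmaAntidiagonalEquivProd.hasSum_iff] at h
  refine h.sigma fun k => ?_
  rw [← sum_antidiagonal_doubleTerm, ← Finset.sum_coe_sort]
  exact hasSum_fintype _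

theorem lseriesHasSum_sum_smul_F {ι : Type*} (S : Finset ι) (q : ι → ℚ) (e : ι → ℕ)
    (s : {s : ℂ // 2 < s.re}) :
    LSeriesHasSum (fun k => ((∑ i ∈ S, q i * ratioPowSum (e i) k : ℚ) : ℂ)) s
      ((∑ i ∈ S, q i • F (e i)) s) := by
  have h : HasSum _ _ := hasSum_sum (s := S) fun i _ =>
    (show HasSum _ _ from lseriesHasSum_Z (e i) s.2).mul_left (q i : ℂ)
  have hterm : LSeries.term (fun k => ((∑ i ∈ S, q i * ratioPowSum (e i) k : ℚ) : ℂ)) s.1 =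
      fun k => ∑ i ∈ S, (q i : ℂ) * LSeries.term (fun k => (ratioPowSum (e i) k : ℂ)) s.1 k := by
    ext k
    rcases eq_or_ne k 0 with rfl | hk
    · simp
    · simp [LSeries.term_of_ne_zero hk, Finset.sum_div, mul_div_assoc]
  have hval : (∑ i ∈ S, q i • F (e i)) s = ∑ i ∈ S, (q i : ℂ) * Z (e i) s.1 := by
    simp [F, Rat.smul_def]
  rw [LSeriesHasSum, hterm, hval]
  exact h

theorem sum_ratioPowSum_eq_zero {ι : Type*} {S : Finset ι} {q : ι → ℚ} {e : ι → ℕ}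
    (h : ∑ i ∈ S, q i • F (e i) = 0) {k : ℕ} (hk : k ≠ 0) :
    ∑ i ∈ S, q i * ratioPowSum (e i) k = 0 := by
  have hs := lseriesHasSum_sum_smul_F S q e
  rw [h] at hs
  have h3 := hs ⟨3, by norm_num⟩
  have key := LSeries.eq_of_LSeries_eventually_eq (g := 0)
    (h3.LSeriesSummable.abscissaOfAbsConv_le.trans_lt (EReal.coe_lt_top _))
    ((LSeriesSummable_zero (s := 0)).abscissaOfAbsConv_le.trans_lt (EReal.coe_lt_top _)) ?_ hk
  · rw [Pi.zero_apply] at key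
    exact_mod_cast key
  · filter_upwards [Filter.eventually_gt_atTop (2 : ℝ)] with x hx
    simpa using (hs ⟨x, by simpa using hx⟩).LSeries_eq

theorem sum_smul_F_eq {ι : Type*} {S : Finset ι} {q : ι → ℚ} {e : ι → ℕ} {c : ℕ}
    (h : ∀ k, ratioPowSum c k = ∑ i ∈ S, q i * ratioPowSum (e i) k) :
    F c = ∑ i ∈ S, q i • F (e i) := by
  ext s
  have h1 := lseriesHasSum_sum_smul_F S q e s
  simp_rw [← h] at h1
  exact (lseriesHasSum_Z c s.2).unique h1

/-- Reflection `m ↦ k - m`. -/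
theorem ratioPowSum_reflect (c k : ℕ) :
    ratioPowSum c k = ∑ j ∈ Finset.range (c + 1), (-1) ^ j * (c.choose j : ℚ) * ratioPowSum j k := by
  rcases eq_or_ne k 0 with rfl | hk
  · simp [ratioPowSum]
  have hk' : (k : ℚ) ≠ 0 := by exact_mod_cast hk
  simp only [ratioPowSum, Finset.mul_sum]
  rw [Finset.sum_comm, ← Finset.Nat.sum_antidiagonal_swap]
  refine Finset.sum_congr rfl fun p hp => ?_
  rw [Finset.HasAntidiagonal.mem_antidiagonal] at hp
  simp only [Prod.fst_swap, Prod.snd_swap, or_comm (a := p.2 = 0)]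
  split_ifs
  · simp
  · have : (p.2 : ℚ) / k = -((p.1 : ℚ) / k) + 1 := by
      field_simp; rw [← hp]; push_cast; ring
    rw [this, add_pow]
    refine Finset.sum_congr rfl fun j _ => ?_
    rw [neg_pow]; ring

theorem F_mem_span_even {N c : ℕ} (hc : c ≤ N) :
    F c ∈ Submodule.span ℚ (Set.range fun k : Fin (N / 2 + 1) => F (2 * (k : ℕ))) := by
  induction c using Nat.strong_induction_on with
  | _ c ih =>
  rcases Nat.even_or_odd' c with ⟨l, rfl | hl⟩
  · exact Submodule.subset_span ⟨⟨l, by omega⟩, rfl⟩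
  · have hodd : Odd c := ⟨l, hl⟩
    rw [sum_smul_F_eq (S := Finset.range c) (e := id)
      (q := fun j => (-1) ^ j * (c.choose j : ℚ) / 2) (c := c)]
    · refine Submodule.sum_mem _ fun j hj => Submodule.smul_mem _ _ ?_
      have := Finset.mem_range.1 hj
      exact ih j this (by omega)
    · intro k
      have h := ratioPowSum_reflect c k
      rw [Finset.sum_range_succ, hodd.neg_one_pow, Nat.choose_self] at h
      simp only [id, div_mul_eq_mul_div]
      rw [← Finset.sum_div]
      push_cast at h
      linarith

theorem bernoulli_two_mul_ne_zero (l : ℕ) : bernoulli (2 * l) ≠ 0 := by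
  rcases eq_or_ne l 0 with rfl | hl
  · simp
  intro h
  have hs := hasSum_zeta_nat hl
  rw [h] at hs
  have := le_hasSum hs 1 fun n _ => by positivity
  norm_num at this

open Polynomial in
/-- The polynomial in `k` equal to `∑_{0 < m < k} m^c`. -/
noncomputable def faulhaber (c : ℕ) : ℚ[X] :=
  ∑ i ∈ Finset.range (c + 1),
    C (_root_.bernoulli i * ((c + 1).choose i : ℚ) / (c + 1)) * X ^ (c + 1 - i) - C (if c = 0 then 1 else 0)

theorem eval_faulhaber (c : ℕ) {k : ℕ} (hk : k ≠ 0) :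
    (faulhaber c).eval (k : ℚ) = (k : ℚ) ^ c * ratioPowSum c k := by
  have hk' : (k : ℚ) ≠ 0 := by exact_mod_cast hk
  have h := sum_range_pow k c
  have h2 : (faulhaber c).eval (k : ℚ) =
      ∑ m ∈ Finset.range k, (m : ℚ) ^ c - if c = 0 then 1 else 0 := by
    rw [h, faulhaber]
    simp only [Polynomial.eval_sub, Polynomial.eval_finsetSum, Polynomial.eval_mul,
      Polynomial.eval_C, Polynomial.eval_pow, Polynomial.eval_X]
    congr 1
    exact Finset.sum_congr rfl fun i _ => by ring
  have h3 : (if c = 0 then (1 : ℚ) else 0) =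
      ∑ m ∈ Finset.range k, if m = 0 then (m : ℚ) ^ c else 0 := by
    rw [Finset.sum_ite_eq' (Finset.range k) 0 fun m : ℕ => (m : ℚ) ^ c]
    simp [Nat.pos_of_ne_zero hk, zero_pow_eq]
  rw [h2, h3, ← Finset.sum_sub_distrib, ratioPowSum,
    Finset.Nat.sum_antidiagonal_eq_sum_range_succ_mk, Finset.sum_range_succ]
  simp only [Nat.sub_self, or_true, if_true, add_zero]
  rw [Finset.mul_sum]
  refine Finset.sum_congr rfl fun m hm => ?_
  have : k - m ≠ 0 := by have := Finset.mem_range.1 hm; omega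
  by_cases h0 : m = 0
  · simp [h0]
  · simp only [h0, this, or_self, if_false, sub_zero]
    rw [div_pow]
    field_simp

theorem coeff_zero_faulhaber {c : ℕ} (hc : c ≠ 0) : (faulhaber c).coeff 0 = 0 := by
  simp only [faulhaber, Polynomial.finsetSum_coeff,
    Polynomial.coeff_C_mul_X_pow, hc, if_false, map_zero, sub_zero]
  refine Finset.sum_eq_zero fun i hi => if_neg ?_
  have := Finset.mem_range.1 hi
  omega

theorem coeff_one_faulhaber (c : ℕ) : (faulhaber c).coeff 1 = bernoulli c := by
  have hc : (c : ℚ) + 1 ≠ 0 := by positivity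
  rw [faulhaber, Polynomial.coeff_sub, Polynomial.coeff_C_succ, Polynomial.finsetSum_coeff,
    Finset.sum_eq_single c]
  · simp
    field_simp
  · intro i hi hne
    rw [Polynomial.coeff_C_mul_X_pow, if_neg]
    have := Finset.mem_range.1 hi
    omega
  · simp

theorem eq_zero_of_sum_ratioPowSum {q : ℕ → ℚ} {L : ℕ}
    (h : ∀ k : ℕ, k ≠ 0 → ∑ l ∈ Finset.range L, q l * ratioPowSum (2 * l) k = 0) :
    ∀ l < L, q l = 0 := by
  induction L with
  | zero => simp
  | succ L ih =>
    have hL : q L = 0 := by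
      set P : Polynomial ℚ := ∑ l ∈ Finset.range (L + 1),
        Polynomial.C (q l) * (faulhaber (2 * l) * Polynomial.X ^ (2 * L - 2 * l)) with hP
      have hP0 : P = 0 := by
        refine Polynomial.eq_zero_of_infinite_isRoot P ?_
        refine Set.Infinite.mono ?_
          ((Set.infinite_range_of_injective Nat.succ_injective).image
            (Nat.cast_injective (R := ℚ)).injOn)
        rintro _ ⟨_, ⟨k, rfl⟩, rfl⟩
        have hk := h k.succ k.succ_ne_zero
        simp only [Set.mem_ofPred_eq, Polynomial.IsRoot, hP, Polynomial.eval_finsetSum,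
          Polynomial.eval_mul, Polynomial.eval_C, Polynomial.eval_pow, Polynomial.eval_X,
          eval_faulhaber _ k.succ_ne_zero]
        rw [← mul_zero (((k.succ : ℕ) : ℚ) ^ (2 * L)), ← hk, Finset.mul_sum]
        refine Finset.sum_congr rfl fun l hl => ?_
        have hl' := Finset.mem_range.1 hl
        rw [show 2 * L = 2 * l + (2 * L - 2 * l) by omega, pow_add, Nat.add_sub_cancel_left]
        ring
      have hc : P.coeff 1 = q L * bernoulli (2 * L) := by
        rw [hP, Polynomial.finsetSum_coeff, Finset.sum_range_succ, Finset.sum_eq_zero]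
        · simp [coeff_one_faulhaber]
        · intro l hl
          have hl' := Finset.mem_range.1 hl
          rw [Polynomial.coeff_C_mul, Polynomial.coeff_mul_X_pow', if_neg (by omega), mul_zero]
      rw [hP0, Polynomial.coeff_zero] at hc
      exact (mul_eq_zero.1 hc.symm).resolve_right (bernoulli_two_mul_ne_zero L)
    intro l hl
    rcases Nat.lt_succ_iff_lt_or_eq.1 hl with hl | rfl
    · refine ih (fun k hk => ?_) l hl
      simpa [Finset.sum_range_succ, hL] using h k hk
    · exact hL

theorem linearIndependent_F_even : LinearIndependent ℚ fun l : ℕ => F (2 * l) := by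
  rw [linearIndependent_iff']
  intro S g hg i hi
  have hS : ∀ k ∈ S, k ∈ Finset.range (S.sup id + 1) := fun k hk =>
    Finset.mem_range.2 (Nat.lt_succ_of_le (Finset.le_sup (f := id) hk))
  have := eq_zero_of_sum_ratioPowSum (q := fun l => if l ∈ S then g l else 0)
    (L := S.sup id + 1) (fun k hk => ?_) i (Finset.mem_range.1 (hS i hi))
  · simpa [hi] using this
  · refine Eq.trans ?_ (sum_ratioPowSum_eq_zero hg hk)
    simp only [ite_mul, zero_mul]
    rw [← Finset.sum_filter]
    congr 1
    ext l
    simpa using fun hl => Finset.mem_range.1 (hS l hl)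

/-- The functions `s ↦ Z_0(s), Z_2(s), …, Z_{2⌊N/2⌋}(s)` are `ℚ`-linearly independent;
consequently the `ℚ`-span of `{s ↦ Z_c(s) : 0 ≤ c ≤ N}` has dimension `⌊N/2⌋ + 1`. -/
theorem linearIndependent_and_finrank (N : ℕ) :
    LinearIndependent ℚ (fun k : Fin (N / 2 + 1) => F (2 * (k : ℕ))) ∧
    Module.finrank ℚ (Submodule.span ℚ (F '' {c | c ≤ N})) = N / 2 + 1 := by
  have hli : LinearIndependent ℚ (fun k : Fin (N / 2 + 1) => F (2 * (k : ℕ))) :=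
    linearIndependent_F_even.comp _ Fin.val_injective
  refine ⟨hli, ?_⟩
  have hspan : Submodule.span ℚ (F '' {c | c ≤ N}) =
      Submodule.span ℚ (Set.range fun k : Fin (N / 2 + 1) => F (2 * (k : ℕ))) := by
    refine le_antisymm (Submodule.span_le.2 ?_) (Submodule.span_mono ?_)
    · rintro _ ⟨c, hc, rfl⟩
      exact F_mem_span_even hc
    · rintro _ ⟨k, rfl⟩
      exact ⟨2 * (k : ℕ), by have := k.2; simp only [Set.mem_ofPred_eq]; omega, rfl⟩
  rw [hspan, finrank_span_eq_card hli, Fintype.card_fin]
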